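/- arXiv:1307.2520 — 4 statements merged into one kernel-verified Lean document; each statement's English description precedes it below -/
import Mathlib

section
/- Let M be a metric space, let X ⊆ M be a finite set with |X| = t, let h be an integer with 1 ≤ h ≤ t, and let Y ⊆ M be a finite nonempty set. Then there exists a nonempty subset S ⊆ Y with |S| ≤ t/h such that for every y ∈ Y, the distance from y to the set S satisfies d(y, S) ≤ 2 · dist_h(X, y). -/
/-- `kthDist S p i` is the `i`-th smallest value (1-indexed) among the distances
`dist p s` for `s ∈ S`, i.e. the radius of the smallest closed ball centered at `p`
containing at least `i` points of `S`. -/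
noncomputable def kthDist {M : Type*} [MetricSpace M] (S : Finset M) (p : M) (i : ℕ) : ℝ :=
  ((S.val.map (fun s => dist p s)).sort (· ≤ ·)).getD (i - 1) 0

/-- At least `i` points of `S` lie within distance `kthDist S p i` of `p`. -/
theorem le_card_filter_dist_le_kthDist {M : Type*} [MetricSpace M] (S : Finset M) (p : M)
    {i : ℕ} (hi : 1 ≤ i) (hS : i ≤ S.card) :
    i ≤ (S.filter fun x => dist p x ≤ kthDist S p i).card := by
  set l := (S.val.map fun s => dist p s).sort (· ≤ ·) with hl
  have hlen : l.length = S.card := by simp [hl]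
  have hk : kthDist S p i = l[i - 1]'(by omega) :=
    List.getD_eq_getElem l 0 (by omega)
  have hsorted : l.Pairwise (· ≤ ·) := Multiset.pairwise_sort _ _
  have htake : (l.take i).countP (fun x => decide (x ≤ kthDist S p i)) = i := by
    rw [List.countP_eq_length.2, List.length_take, hlen, min_eq_left hS]
    intro x hx
    obtain ⟨j, hj, rfl⟩ := List.mem_iff_getElem.1 hx
    have hji : j < i := lt_of_lt_of_le hj (by simp)
    simp only [List.getElem_take, decide_eq_true_eq, hk]
    rcases (Nat.le_sub_one_of_lt hji).eq_or_lt with rfl | hlt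
    · exact le_rfl
    · exact List.pairwise_iff_getElem.1 hsorted _ _ _ _ hlt
  have hcount : (S.filter fun x => dist p x ≤ kthDist S p i).card =
      l.countP (fun x => decide (x ≤ kthDist S p i)) := by
    rw [← Multiset.coe_countP, hl, Multiset.sort_eq, Multiset.countP_map]
    rfl
  rw [hcount]
  exact htake.symm.le.trans ((List.take_sublist i l).countP_le)

/-- Finite greedy selection: from a family of nonempty finite sets indexed by `Y`, one can select
pairwise disjoint members such that each member meets a selected one of no larger weight. -/
theorem exists_pairwiseDisjoint_subset_not_disjoint {ι α R : Type*} [DecidableEq ι] [LinearOrder R]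
    (Y : Finset ι) (B : ι → Finset α) (r : ι → R) (hB : ∀ y ∈ Y, (B y).Nonempty) :
    ∃ S ⊆ Y, (S : Set ι).PairwiseDisjoint B ∧
      ∀ y ∈ Y, ∃ s ∈ S, r s ≤ r y ∧ ¬ Disjoint (B s) (B y) := by
  induction Y using Finset.induction_on_max_value r with
  | empty => exact ⟨∅, by simp⟩
  | insert a Y ha hmax ih =>
    obtain ⟨S, hSY, hdisj, hS⟩ := ih fun y hy => hB y (Finset.mem_insert_of_mem hy)
    by_cases hmeet : ∃ s ∈ S, ¬ Disjoint (B s) (B a)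
    · refine ⟨S, hSY.trans (Finset.subset_insert _ _), hdisj, fun y hy => ?_⟩
      obtain rfl | hy := Finset.mem_insert.1 hy
      · obtain ⟨s, hs, hsa⟩ := hmeet
        exact ⟨s, hs, hmax s (hSY hs), hsa⟩
      · exact hS y hy
    · push Not at hmeet
      refine ⟨insert a S, Finset.insert_subset_insert _ hSY, ?_, fun y hy => ?_⟩
      · rw [Finset.coe_insert]
        exact hdisj.insert fun s hs _ => (hmeet s hs).symm
      · obtain rfl | hy := Finset.mem_insert.1 hy
        · exact ⟨y, Finset.mem_insert_self _ _, le_rfl,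
            fun h => (hB y (Finset.mem_insert_self _ _)).ne_empty (disjoint_self.1 h)⟩
        · obtain ⟨s, hs, hsy⟩ := hS y hy
          exact ⟨s, Finset.mem_insert_of_mem hs, hsy⟩

/-- Let `X ⊆ M` be a finite set with `|X| = t`, `h` an integer with
`1 ≤ h ≤ t`, and `Y ⊆ M` a finite nonempty set.  Then there exists a nonempty subset
`S ⊆ Y` with `|S| ≤ t / h` such that for every `y ∈ Y`,
`d(y, S) ≤ 2 · dist_h(X, y)`. -/
theorem exists_sparse_hitting_subset {M : Type*} [MetricSpace M]
    (X Y : Finset M) (t h : ℕ) (ht : X.card = t) (hh1 : 1 ≤ h) (hht : h ≤ t)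
    (hY : Y.Nonempty) :
    ∃ S : Finset M, S ⊆ Y ∧ S.Nonempty ∧ (S.card : ℝ) ≤ (t : ℝ) / (h : ℝ) ∧
      ∀ y ∈ Y, Metric.infDist y (S : Set M) ≤ 2 * kthDist X y h := by
  classical
  subst ht
  set r : M → ℝ := fun y => kthDist X y h
  set B : M → Finset M := fun y => X.filter fun x => dist y x ≤ r y with hBdef
  have hcard : ∀ y, h ≤ (B y).card := fun y => le_card_filter_dist_le_kthDist X y hh1 hht
  obtain ⟨S, hSY, hdisj, hS⟩ := exists_pairwiseDisjoint_subset_not_disjoint Y B r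
    fun y _ => Finset.card_pos.1 (hh1.trans (hcard y))
  refine ⟨S, hSY, ?_, ?_, fun y hy => ?_⟩
  · obtain ⟨y, hy⟩ := hY
    obtain ⟨s, hs, -⟩ := hS y hy
    exact ⟨s, hs⟩
  · have hle : S.card * h ≤ X.card :=
      calc S.card * h ≤ ∑ s ∈ S, (B s).card := by
            simpa using Finset.card_nsmul_le_sum S (fun s => (B s).card) h fun s _ => hcard s
        _ = (S.biUnion B).card := (Finset.card_biUnion hdisj).symm
        _ ≤ X.card := Finset.card_le_card
            (Finset.biUnion_subset.2 fun s _ => Finset.filter_subset _ _)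
    rw [le_div_iff₀ (by exact_mod_cast hh1)]
    exact_mod_cast hle
  · obtain ⟨s, hs, hsy, hmeet⟩ := hS y hy
    obtain ⟨x, hxs, hxy⟩ := Finset.not_disjoint_iff.1 hmeet
    simp only [hBdef, Finset.mem_filter] at hxs hxy
    calc Metric.infDist y (S : Set M) ≤ dist y s := Metric.infDist_le_dist_of_mem hs
      _ ≤ dist y x + dist s x := dist_triangle_right _ _ _
      _ ≤ 2 * r y := by linarith [hxs.2, hxy.2]
end

section
/- Let P be a finite nonempty subset of a metric space M, let k, ℓ be integers with 1 ≤ ℓ ≤ k ≤ |P|, and set m = ⌊k/ℓ⌋. Let c ≥ 0 be a real number and let Q ⊆ P with |Q| = m satisfy Σ_{p ∈ P} dist_1(Q, p) ≤ c·σ_med. Let C ⊆ P be any set such that for every q ∈ Q, C contains at least ℓ points of P each within distance dist_ℓ(P, q) of q (equivalently, dist_ℓ(C, q) = dist_ℓ(P, q)). Then Σ_{p ∈ P} dist_ℓ(C, p) ≤ σ_opt + 2c·σ_med. -/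
theorem List.getD_le_iff_lt_countP {l : List ℝ} (hl : l.Pairwise (· ≤ ·)) {i : ℕ}
    (hi : i < l.length) (d r : ℝ) : l.getD i d ≤ r ↔ i < l.countP (· ≤ r) := by
  induction l generalizing i with
  | nil => simp at hi
  | cons a t ih =>
    rw [List.pairwise_cons] at hl
    rcases le_or_gt a r with ha | ha
    · cases i with
      | zero => simp [ha]
      | succ j =>
        simp only [List.getD_cons_succ, ha, decide_true, List.countP_cons_of_pos,
          Nat.add_lt_add_iff_right]
        exact ih hl.2 (by simpa using hi)
    · have ht : t.countP (· ≤ r) = 0 := by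
        rw [List.countP_eq_zero]
        intro b hb
        simpa using ha.trans_le (hl.1 b hb)
      have hlt : r < (a :: t).getD i d := by
        rw [List.getD_eq_getElem _ _ hi]
        rcases List.mem_cons.1 (List.getElem_mem hi) with h | h
        · rwa [h]
        · exact ha.trans_le (hl.1 _ h)
      rw [List.countP_cons_of_neg (by simpa using ha), ht]
      exact iff_of_false hlt.not_ge (Nat.not_lt_zero i)

section kthDist

variable {M : Type*} [MetricSpace M]

theorem kthDist_le_iff {S : Finset M} {p : M} {i : ℕ} (hi : 1 ≤ i) (hiS : i ≤ S.card) (r : ℝ) :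
    kthDist S p i ≤ r ↔ i ≤ (S.filter (fun x => dist p x ≤ r)).card := by
  have hcount : ((S.val.map (fun s => dist p s)).sort (· ≤ ·)).countP (· ≤ r) =
      (S.filter (fun x => dist p x ≤ r)).card := by
    rw [← Multiset.coe_countP, Multiset.sort_eq, Multiset.countP_map]
    rfl
  rw [kthDist, List.getD_le_iff_lt_countP (Multiset.pairwise_sort _ _) (by simp; lia), hcount]
  lia

theorem kthDist_le_of_le_card_filter {S : Finset M} {p : M} {i : ℕ} (hi : 1 ≤ i) {r : ℝ}
    (h : i ≤ (S.filter (fun x => dist p x ≤ r)).card) : kthDist S p i ≤ r :=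
  (kthDist_le_iff hi (h.trans (Finset.card_filter_le _ _)) r).2 h

theorem le_card_filter_kthDist {S : Finset M} (p : M) {i : ℕ} (hi : 1 ≤ i) (hiS : i ≤ S.card) :
    i ≤ (S.filter (fun x => dist p x ≤ kthDist S p i)).card :=
  (kthDist_le_iff hi hiS _).1 le_rfl

theorem kthDist_anti {S T : Finset M} (hST : S ⊆ T) (p : M) {i : ℕ} (hi : 1 ≤ i)
    (hiS : i ≤ S.card) : kthDist T p i ≤ kthDist S p i :=
  kthDist_le_of_le_card_filter hi <|
    (le_card_filter_kthDist p hi hiS).trans (Finset.card_le_card (Finset.filter_subset_filter _ hST))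

theorem le_card_filter_dist_add {S : Finset M} (p q : M) {i : ℕ} {r : ℝ}
    (h : i ≤ (S.filter (fun x => dist q x ≤ r)).card) :
    i ≤ (S.filter (fun x => dist p x ≤ dist p q + r)).card := by
  refine h.trans (Finset.card_le_card (Finset.monotone_filter_right _ fun x _ hx => ?_))
  linarith [dist_triangle p q x]

theorem kthDist_le_dist_add_kthDist {S : Finset M} (p q : M) {i : ℕ} (hi : 1 ≤ i)
    (hiS : i ≤ S.card) : kthDist S p i ≤ dist p q + kthDist S q i :=
  kthDist_le_of_le_card_filter hi (le_card_filter_dist_add p q (le_card_filter_kthDist q hi hiS))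

theorem exists_mem_dist_le_kthDist_one {S : Finset M} (hS : 1 ≤ S.card) (p : M) :
    ∃ q ∈ S, dist p q ≤ kthDist S p 1 := by
  obtain ⟨q, hq⟩ := Finset.card_pos.1 (le_card_filter_kthDist p le_rfl hS)
  exact ⟨q, (Finset.mem_filter.1 hq).1, (Finset.mem_filter.1 hq).2⟩

end kthDist

/-- Let `P` be a finite nonempty subset of a metric space,
`1 ≤ ℓ ≤ k ≤ |P|`, `m = ⌊k/ℓ⌋`.  Let `c ≥ 0` and let `Q ⊆ P` with `|Q| = m` satisfy
`Σ_{p ∈ P} dist_1(Q, p) ≤ c·σ_med`.  Let `C ⊆ P` be any set such that for every `q ∈ Q`,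
`C` contains at least `ℓ` points of `P` each within distance `dist_ℓ(P, q)` of `q`.
Then `Σ_{p ∈ P} dist_ℓ(C, p) ≤ σ_opt + 2c·σ_med`. -/
theorem median_cost_le_opt_add_two_c_med {M : Type*} [MetricSpace M]
    (P : Finset M) (hP : P.Nonempty) (k ℓ : ℕ)
    (hl1 : 1 ≤ ℓ) (hlk : ℓ ≤ k) (hkP : k ≤ P.card)
    (σopt σmed : ℝ)
    (hopt : IsLeast {x : ℝ | ∃ C : Finset M, C ⊆ P ∧ C.card = k ∧
      x = ∑ p ∈ P, kthDist C p ℓ} σopt)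
    (hmed : IsLeast {x : ℝ | ∃ Q : Finset M, Q ⊆ P ∧ Q.card = k / ℓ ∧
      x = ∑ p ∈ P, kthDist Q p 1} σmed)
    (c : ℝ) (hc : 0 ≤ c)
    (Q : Finset M) (hQP : Q ⊆ P) (hQcard : Q.card = k / ℓ)
    (hQapprox : ∑ p ∈ P, kthDist Q p 1 ≤ c * σmed)
    (C : Finset M) (hCP : C ⊆ P)
    (hC : ∀ q ∈ Q, ℓ ≤ (C.filter (fun x => dist q x ≤ kthDist P q ℓ)).card) :
    ∑ p ∈ P, kthDist C p ℓ ≤ σopt + 2 * c * σmed := by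
  obtain ⟨⟨O, hOP, hOcard, rfl⟩, -⟩ := hopt
  have hQ1 : 1 ≤ Q.card := hQcard ▸ Nat.div_pos hlk hl1
  have key (p : M) : kthDist C p ℓ ≤ kthDist O p ℓ + 2 * kthDist Q p 1 := by
    obtain ⟨q, hq, hpq⟩ := exists_mem_dist_le_kthDist_one hQ1 p
    have hCq := kthDist_le_of_le_card_filter hl1 (le_card_filter_dist_add p q (hC q hq))
    have hPq := kthDist_le_dist_add_kthDist q p hl1 (hlk.trans hkP)
    have hOp := kthDist_anti hOP p hl1 (hlk.trans hOcard.ge)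
    rw [dist_comm q p] at hPq
    linarith
  calc ∑ p ∈ P, kthDist C p ℓ
      ≤ ∑ p ∈ P, (kthDist O p ℓ + 2 * kthDist Q p 1) := Finset.sum_le_sum fun p _ => key p
    _ = ∑ p ∈ P, kthDist O p ℓ + 2 * ∑ p ∈ P, kthDist Q p 1 := by
      rw [Finset.sum_add_distrib, Finset.mul_sum]
    _ ≤ ∑ p ∈ P, kthDist O p ℓ + 2 * c * σmed := by linarith
end

section
/- Let P be a finite nonempty subset of a metric space M, let k, ℓ be integers with 1 ≤ ℓ ≤ k ≤ |P|, and set m = ⌊k/ℓ⌋. Then r_cen ≤ 2·r_opt, where r_cen is the optimal (non-fault-tolerant) m-center cost of P and r_opt is the optimal fault-tolerant k-center cost of P with fault-tolerance parameter ℓ. -/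
/-- In a sorted list, the entry of index `j` is at most `r` iff more than `j` entries are. -/
theorem List.getD_le_iff_lt_countP_s5 {L : List ℝ} (hL : L.Pairwise (· ≤ ·)) (r : ℝ) (j : ℕ)
    (hj : j < L.length) : L.getD j 0 ≤ r ↔ j < L.countP (fun x => decide (x ≤ r)) := by
  induction L generalizing j with
  | nil => simp at hj
  | cons a L ih =>
    rw [List.pairwise_cons] at hL
    rw [List.countP_cons]
    by_cases har : a ≤ r
    · cases j with
      | zero => simp [har]
      | succ j =>
        simp only [List.length_cons, Nat.add_lt_add_iff_right] at hj
        simpa [har] using ih hL.2 j hj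
    · have hgt : ∀ x ∈ L, ¬ x ≤ r := fun x hx h => har ((hL.1 x hx).trans h)
      have hcount : L.countP (fun x => decide (x ≤ r)) = 0 := by
        simpa [List.countP_eq_zero] using hgt
      cases j with
      | zero => simp [har, hcount]
      | succ j =>
        simp only [List.length_cons, Nat.add_lt_add_iff_right] at hj
        simpa [har, hcount] using ih hL.2 j hj

/-- The `i`-th smallest distance from `p` to `S` is at most `r` iff the closed ball of radius `r`
around `p` contains at least `i` points of `S`. -/
theorem kthDist_le_iff_le_card_filter {M : Type*} [MetricSpace M] (S : Finset M) (p : M) {i : ℕ}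
    (hi : 1 ≤ i) (hiS : i ≤ S.card) (r : ℝ) :
    kthDist S p i ≤ r ↔ i ≤ (S.filter (fun s => dist p s ≤ r)).card := by
  have hcount : ((S.val.map (fun s => dist p s)).sort (· ≤ ·)).countP (fun x => decide (x ≤ r)) =
      (S.filter (fun s => dist p s ≤ r)).card := by
    rw [← Multiset.coe_countP, Multiset.sort_eq, Multiset.countP_map]
    rfl
  unfold kthDist
  rw [List.getD_le_iff_lt_countP_s5 (Multiset.pairwise_sort _ _) r (i - 1)
    (by rw [Multiset.length_sort, Multiset.card_map, Finset.card_val]; lia), hcount]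
  lia

/-- A finite set contains an `r`-separated subset that is an `r`-net. -/
theorem Finset.exists_separated_net {M : Type*} [MetricSpace M] (P : Finset M) {r : ℝ}
    (hr : 0 ≤ r) : ∃ Q ⊆ P, (Q : Set M).Pairwise (fun a b => r < dist a b) ∧
      ∀ p ∈ P, ∃ q ∈ Q, dist p q ≤ r := by
  classical
  obtain ⟨Q, hQ, hmax⟩ := Finset.exists_max_image
    (P.powerset.filter fun Q : Finset M => (Q : Set M).Pairwise (fun a b => r < dist a b))
    Finset.card ⟨∅, by simp⟩
  rw [Finset.mem_filter, Finset.mem_powerset] at hQ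
  refine ⟨Q, hQ.1, hQ.2, fun p hp => ?_⟩
  by_contra! hfar
  have hpQ : p ∉ Q := fun h => (hfar p h).not_ge (by simpa using hr)
  have hle := hmax (insert p Q) (by
    rw [Finset.mem_filter, Finset.mem_powerset, Finset.coe_insert]
    refine ⟨Finset.insert_subset hp hQ.1, hQ.2.insert fun q hq _ => ⟨hfar q hq, ?_⟩⟩
    rw [dist_comm]
    exact hfar q hq)
  rw [Finset.card_insert_of_notMem hpQ] at hle
  lia

/-- Let `P` be a finite nonempty subset of a metric space, `1 ≤ ℓ ≤ k ≤ |P|`,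
and `m = ⌊k/ℓ⌋`.  Then `r_cen ≤ 2·r_opt`, where `r_cen` is the optimal non-fault-tolerant
`m`-center cost of `P` and `r_opt` is the optimal fault-tolerant `k`-center cost of `P` with
fault-tolerance parameter `ℓ`. -/
theorem cen_le_two_mul_opt {M : Type*} [MetricSpace M]
    (P : Finset M) (hP : P.Nonempty) (k ℓ : ℕ)
    (hl1 : 1 ≤ ℓ) (hlk : ℓ ≤ k) (hkP : k ≤ P.card)
    (ropt rcen : ℝ)
    (hopt : IsLeast {x : ℝ | ∃ C : Finset M, C ⊆ P ∧ C.card = k ∧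
      x = P.sup' hP (fun p => kthDist C p ℓ)} ropt)
    (hcen : IsLeast {x : ℝ | ∃ Q : Finset M, Q ⊆ P ∧ Q.card = k / ℓ ∧
      x = P.sup' hP (fun p => kthDist Q p 1)} rcen) :
    rcen ≤ 2 * ropt := by
  classical
  obtain ⟨⟨C, -, hCk, hCr⟩, -⟩ := hopt
  have hball : ∀ p ∈ P, ℓ ≤ (C.filter (fun s => dist p s ≤ ropt)).card := fun p hp =>
    (kthDist_le_iff_le_card_filter C p hl1 (hCk ▸ hlk) ropt).1
      (hCr ▸ Finset.le_sup' (fun p => kthDist C p ℓ) hp)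
  have hr : 0 ≤ ropt := by
    obtain ⟨p, hp⟩ := hP
    obtain ⟨s, hs⟩ := Finset.card_pos.1 (hl1.trans (hball p hp))
    exact dist_nonneg.trans (Finset.mem_filter.1 hs).2
  obtain ⟨Q, hQP, hsep, hnet⟩ := P.exists_separated_net (mul_nonneg zero_le_two hr)
  have hcard : Q.card * ℓ ≤ k := by
    have hdisj : (Q : Set M).PairwiseDisjoint
        (fun q => C.filter (fun s => dist q s ≤ ropt)) := by
      intro a ha b hb hab
      refine Finset.disjoint_left.2 fun s hsa hsb => ?_
      have h₁ := (Finset.mem_filter.1 hsa).2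
      have h₂ := (Finset.mem_filter.1 hsb).2
      have h₃ := dist_triangle_right a b s
      have h₄ : 2 * ropt < dist a b := hsep ha hb hab
      linarith
    calc Q.card * ℓ ≤ ∑ q ∈ Q, (C.filter (fun s => dist q s ≤ ropt)).card := by
          simpa using Finset.card_nsmul_le_sum Q _ ℓ fun q hq => hball q (hQP hq)
      _ = (Q.biUnion fun q => C.filter (fun s => dist q s ≤ ropt)).card :=
          (Finset.card_biUnion hdisj).symm
      _ ≤ C.card := Finset.card_le_card
          (Finset.biUnion_subset.2 fun q _ => Finset.filter_subset _ _)
      _ = k := hCk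
  obtain ⟨R, hQR, hRP, hRcard⟩ := Finset.exists_subsuperset_card_eq hQP
    ((Nat.le_div_iff_mul_le hl1).2 hcard) ((Nat.div_le_self k ℓ).trans hkP)
  refine (hcen.2 ⟨R, hRP, hRcard, rfl⟩).trans (Finset.sup'_le hP _ fun p hp => ?_)
  obtain ⟨q, hq, hpq⟩ := hnet p hp
  exact (kthDist_le_iff_le_card_filter R p le_rfl (hRcard ▸ Nat.div_pos hlk hl1) _).2
    (Finset.card_pos.2 ⟨q, Finset.mem_filter.2 ⟨hQR hq, hpq⟩⟩)
end

section
/- Let P be a finite nonempty subset of a metric space M and let q_1, …, q_m (m ≥ 2) be a Gonzalez sequence in P, with Q_{i-1} = {q_1, …, q_{i-1}} and r_i = d(q_i, Q_{i-1}) for 2 ≤ i ≤ m. Then for all indices 1 ≤ i ≠ j ≤ m, d(q_i, q_j) ≥ r_m. -/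
/-- Let `P` be a finite nonempty subset of a metric space and let
`q 1, …, q m` (`m ≥ 2`) be a Gonzalez sequence in `P` (each `q i ∈ P`, and for
`2 ≤ i ≤ m`, `q i` is a point of `P` farthest from `Q_{i-1} = {q 1, …, q (i-1)}`).
With `r_m = d(q m, Q_{m-1})`, for all indices `1 ≤ i ≠ j ≤ m` we have
`d(q i, q j) ≥ r_m`. -/
theorem gonzalez_pairwise_separation {M : Type*} [MetricSpace M] [DecidableEq M]
    (P : Finset M) (hP : P.Nonempty) (m : ℕ) (hm : 2 ≤ m)
    (q : ℕ → M) (hq1 : q 1 ∈ P)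
    (hgonz : ∀ i, 2 ≤ i → i ≤ m → q i ∈ P ∧
      ∀ p ∈ P, Metric.infDist p (((Finset.Icc 1 (i - 1)).image q : Finset M) : Set M) ≤
        Metric.infDist (q i) (((Finset.Icc 1 (i - 1)).image q : Finset M) : Set M)) :
    ∀ i j, 1 ≤ i → i ≤ m → 1 ≤ j → j ≤ m → i ≠ j →
      Metric.infDist (q m) (((Finset.Icc 1 (m - 1)).image q : Finset M) : Set M) ≤
        dist (q i) (q j) := by
  intro i j hi him hj hjm hij
  wlog hlt : i < j generalizing i j
  · rw [dist_comm]
    exact this j i hj hjm hi him hij.symm (by omega)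
  have hmem : q i ∈ (((Finset.Icc 1 (j - 1)).image q : Finset M) : Set M) :=
    Finset.mem_coe.2 (Finset.mem_image_of_mem q (Finset.mem_Icc.2 ⟨hi, by omega⟩))
  have hsub : (((Finset.Icc 1 (j - 1)).image q : Finset M) : Set M) ⊆
      (((Finset.Icc 1 (m - 1)).image q : Finset M) : Set M) :=
    Finset.coe_subset.2 (Finset.image_subset_image (Finset.Icc_subset_Icc le_rfl (by omega)))
  calc
    _ ≤ Metric.infDist (q m) (((Finset.Icc 1 (j - 1)).image q : Finset M) : Set M) :=
      Metric.infDist_le_infDist_of_subset hsub ⟨q i, hmem⟩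
    _ ≤ Metric.infDist (q j) (((Finset.Icc 1 (j - 1)).image q : Finset M) : Set M) :=
      (hgonz j (by omega) hjm).2 (q m) (hgonz m hm le_rfl).1
    _ ≤ dist (q j) (q i) := Metric.infDist_le_dist_of_mem hmem
    _ = dist (q i) (q j) := dist_comm _ _
end
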